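/- Let G be a finite simple graph that is 4-critical. Let G1 and G2 be subgraphs of G with G1 ∪ G2 = G and G1 ∩ G2 = C, where C is a proper subgraph of G1. Then G1 is C-critical for 3-coloring. -/

import Mathlib

noncomputable section

/-- A graph is 4-critical if its chromatic number is `4` and every proper subgraph
has chromatic number at most `3`. -/
def FourCritical {V : Type} (G : SimpleGraph V) : Prop :=
  G.chromaticNumber = 4 ∧
    ∀ H : G.Subgraph, H ≠ ⊤ → H.coe.chromaticNumber ≤ 3

/-- `φ` is a proper 3-coloring of the subgraph `A` (of the ambient graph `G`). -/
def ProperColOn {V : Type} {G : SimpleGraph V} (A : G.Subgraph) (φ : V → Fin 3) : Prop :=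
  ∀ u v : V, A.Adj u v → φ u ≠ φ v

/-- `G1` is `C`-critical for 3-coloring, where `C` and `G1` are subgraphs of an
ambient graph `G`: `C` is a proper subgraph of `G1`, and for every proper subgraph
`H` of `G1` containing `C` there is a proper 3-coloring of `C` that extends to a
proper 3-coloring of `H` but not to a proper 3-coloring of `G1`. -/
def CCritical {V : Type} {G : SimpleGraph V} (G1 C : G.Subgraph) : Prop :=
  C < G1 ∧
    ∀ H : G.Subgraph, C ≤ H → H < G1 →
      ∃ φ : V → Fin 3, ProperColOn C φ ∧
        (∃ ψ : V → Fin 3, ProperColOn H ψ ∧ ∀ v ∈ C.verts, ψ v = φ v) ∧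
        ¬ ∃ ψ : V → Fin 3, ProperColOn G1 ψ ∧ ∀ v ∈ C.verts, ψ v = φ v

/-- Let `G` be a finite simple 4-critical graph, and let `G1`, `G2`
be subgraphs of `G` with `G1 ∪ G2 = G` and `G1 ∩ G2 = C`, where `C` is a proper
subgraph of `G1`.  Then `G1` is `C`-critical for 3-coloring. -/
theorem subgraph_critical {V : Type} [Fintype V] {G : SimpleGraph V}
    (hcrit : FourCritical G) (G1 G2 C : G.Subgraph)
    (hunion : G1 ⊔ G2 = ⊤) (hinter : G1 ⊓ G2 = C) (hproper : C < G1) :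
    CCritical G1 C := by
  classical
  refine ⟨hproper, fun H hCH hHG => ?_⟩
  have hK : H ⊔ G2 ≠ ⊤ := by
    intro h
    have h1 : G1 = H := by
      calc G1 = G1 ⊓ (H ⊔ G2) := by rw [h, inf_top_eq]
        _ = (G1 ⊓ H) ⊔ (G1 ⊓ G2) := inf_sup_left _ _ _
        _ = H := by rw [hinter, inf_eq_right.mpr hHG.le, sup_eq_left.mpr hCH]
    exact hHG.ne h1.symm
  have hcol : (H ⊔ G2).coe.Colorable 3 :=
    SimpleGraph.chromaticNumber_le_iff_colorable.mp (hcrit.2 _ hK)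
  obtain ⟨c⟩ := hcol
  let f : V → Fin 3 := fun v => if h : v ∈ (H ⊔ G2).verts then c ⟨v, h⟩ else 0
  have hf : ProperColOn (H ⊔ G2) f := by
    intro u v huv
    have hu := huv.fst_mem
    have hv := huv.snd_mem
    simp only [f, dif_pos hu, dif_pos hv]
    exact c.valid (v := ⟨u, hu⟩) (w := ⟨v, hv⟩) huv
  have hfH : ProperColOn H f := fun u v h => hf u v (Or.inl h)
  have hfG2 : ProperColOn G2 f := fun u v h => hf u v (Or.inr h)
  refine ⟨f, fun u v h => hfH u v (hCH.2 h), ⟨f, hfH, fun _ _ => rfl⟩, ?_⟩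
  rintro ⟨g, hg, hgf⟩
  let k : V → Fin 3 := fun v => if v ∈ G1.verts then g v else f v
  have hk1 : ∀ v ∈ G1.verts, k v = g v := fun v hv => if_pos hv
  have hk2 : ∀ v ∈ G2.verts, k v = f v := by
    intro v hv
    by_cases h : v ∈ G1.verts
    · rw [hk1 v h]
      apply hgf
      rw [← hinter]
      exact ⟨h, hv⟩
    · exact if_neg h
  have hcolG : G.Colorable 3 := by
    refine ⟨SimpleGraph.Coloring.mk k ?_⟩
    intro u v huv
    have h : (G1 ⊔ G2).Adj u v := by rw [hunion]; exact huv
    rcases h with h | h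
    · rw [hk1 u h.fst_mem, hk1 v h.snd_mem]
      exact hg u v h
    · rw [hk2 u h.fst_mem, hk2 v h.snd_mem]
      exact hfG2 u v h
  have h3 := SimpleGraph.chromaticNumber_le_iff_colorable.mpr hcolG
  rw [hcrit.1] at h3
  exact absurd h3 (by decide)
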